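/- Let ν ∈ ℝ and let Q be an admissible quantization of P of type (i)′ with parameter ν. Then there exist real numbers b and c such that Q(ℓ²) = Q(ℓ)² + b·Q(ℓ) + c·I as linear operators on D. -/

import Mathlib

noncomputable section

open Complex

/-- Partial derivative in the first (angle) variable. -/
def pdTheta (f : ℝ × ℝ → ℝ) : ℝ × ℝ → ℝ := fun p => deriv (fun t => f (t, p.2)) p.1

/-- Partial derivative in the second (momentum) variable. -/
def pdEll (f : ℝ × ℝ → ℝ) : ℝ × ℝ → ℝ := fun p => deriv (fun l => f (p.1, l)) p.2

/-- Poisson bracket `{f,g} = f_ℓ g_θ − f_θ g_ℓ`. -/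
def pb (f g : ℝ × ℝ → ℝ) : ℝ × ℝ → ℝ :=
  fun p => pdEll f p * pdTheta g p - pdTheta f p * pdEll g p

/-- Spanning set for the polynomial algebra `P`. -/
def PGens : Set (ℝ × ℝ → ℝ) :=
  {h | ∃ r m : ℕ, h = (fun p : ℝ × ℝ => p.2 ^ r * Real.sin (m * p.1)) ∨
       h = (fun p : ℝ × ℝ => p.2 ^ r * Real.cos (m * p.1))}

/-- The polynomial algebra `P`. -/
def P : Submodule ℝ (ℝ × ℝ → ℝ) := Submodule.span ℝ PGens

def fone : ℝ × ℝ → ℝ := fun _ => 1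
def fell : ℝ × ℝ → ℝ := fun p => p.2
def fsin : ℝ × ℝ → ℝ := fun p => Real.sin p.1
def fcos : ℝ × ℝ → ℝ := fun p => Real.cos p.1

lemma fone_mem_P : fone ∈ P :=
  Submodule.subset_span ⟨0, 0, Or.inr (by funext p; simp [fone])⟩

lemma fell_mem_P : fell ∈ P :=
  Submodule.subset_span ⟨1, 0, Or.inr (by funext p; simp [fell])⟩

lemma fsin_mem_P : fsin ∈ P :=
  Submodule.subset_span ⟨0, 1, Or.inl (by funext p; simp [fsin])⟩

lemma fcos_mem_P : fcos ∈ P :=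
  Submodule.subset_span ⟨0, 1, Or.inr (by funext p; simp [fcos])⟩

/-- The domain `D = C^∞(S¹,ℂ)`: smooth `2π`-periodic functions. -/
def Dom : Submodule ℂ (ℝ → ℂ) where
  carrier := {ψ | ContDiff ℝ (⊤ : ℕ∞) ψ ∧ ∀ t, ψ (t + 2 * Real.pi) = ψ t}
  add_mem' := by
    intro a b ha hb
    exact ⟨ha.1.add hb.1, fun t => by simp [Pi.add_apply, ha.2 t, hb.2 t]⟩
  zero_mem' := ⟨contDiff_const, fun t => rfl⟩
  smul_mem' := by
    intro c a ha
    exact ⟨ha.1.const_smul c, fun t => by simp [Pi.smul_apply, ha.2 t]⟩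

/-- The `L²` inner product on `D`. -/
def ip (φ ψ : ℝ → ℂ) : ℂ := ∫ t in (0:ℝ)..(2 * Real.pi), (starRingEnd ℂ) (φ t) * ψ t

/-- Symmetric operator on `D`. -/
def SymmetricOp (A : Dom →ₗ[ℂ] Dom) : Prop :=
  ∀ φ ψ : Dom, ip (A φ : ℝ → ℂ) (ψ : ℝ → ℂ) = ip (φ : ℝ → ℂ) (A ψ : ℝ → ℂ)

/-- An admissible quantization of type (i)′ with parameter ν of a Lie subalgebra
`O ⊆ P` containing the basic set. -/
structure IsQuant (O : Submodule ℝ (ℝ × ℝ → ℝ)) (ν : ℝ)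
    (Q : O →ₗ[ℝ] (Dom →ₗ[ℂ] Dom)) : Prop where
  map_bracket : ∀ (f g : O) (h : pb f g ∈ O),
    Q ⟨pb f g, h⟩ = Complex.I • (Q f ∘ₗ Q g - Q g ∘ₗ Q f)
  map_one : ∀ h : fone ∈ O, Q ⟨fone, h⟩ = LinearMap.id
  symm : ∀ f : O, SymmetricOp (Q f)
  map_ell : ∀ (h : fell ∈ O) (ψ : Dom) (t : ℝ),
    (Q ⟨fell, h⟩ ψ : ℝ → ℂ) t = -Complex.I * deriv (ψ : ℝ → ℂ) t + (ν : ℂ) * (ψ : ℝ → ℂ) t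
  map_sin : ∀ (h : fsin ∈ O) (ψ : Dom) (t : ℝ),
    (Q ⟨fsin, h⟩ ψ : ℝ → ℂ) t = (Real.sin t : ℂ) * (ψ : ℝ → ℂ) t
  map_cos : ∀ (h : fcos ∈ O) (ψ : Dom) (t : ℝ),
    (Q ⟨fcos, h⟩ ψ : ℝ → ℂ) t = (Real.cos t : ℂ) * (ψ : ℝ → ℂ) t

end
noncomputable section
def fell2 : ℝ × ℝ → ℝ := fun p => p.2 ^ 2
lemma fell2_mem_P : fell2 ∈ P :=
  Submodule.subset_span ⟨2, 0, Or.inr (by funext p; simp [fell2])⟩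

def flc : ℝ × ℝ → ℝ := fun p => p.2 * Real.cos p.1
def fls : ℝ × ℝ → ℝ := fun p => p.2 * Real.sin p.1

lemma flc_mem_P : flc ∈ P :=
  Submodule.subset_span ⟨1, 1, Or.inr (by funext p; simp [flc])⟩
lemma fls_mem_P : fls ∈ P :=
  Submodule.subset_span ⟨1, 1, Or.inl (by funext p; simp [fls])⟩

lemma pb_ell_ell2 : pb fell fell2 = 0 := by
  funext p; simp [pb, pdEll, pdTheta, fell, fell2]

lemma pb_ell2_sin : pb fell2 fsin = (2 : ℝ) • flc := by
  funext p; simp [pb, pdEll, pdTheta, fsin, fell2, flc]; ring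

lemma pb_ell2_cos : pb fell2 fcos = (-2 : ℝ) • fls := by
  funext p; simp [pb, pdEll, pdTheta, fcos, fell2, fls]; ring

lemma pb_lc_sin : pb flc fsin = fun p => Real.cos p.1 ^ 2 := by
  funext p; simp [pb, pdEll, pdTheta, fsin, flc]; ring

lemma pb_ls_cos : pb fls fcos = fun p => - Real.sin p.1 ^ 2 := by
  funext p; simp [pb, pdEll, pdTheta, fcos, fls]; ring

lemma pb_lc_sin_mem : pb flc fsin ∈ P := by
  have h2 : (fun p : ℝ × ℝ => p.2 ^ 0 * Real.cos ((2 : ℕ) * p.1)) ∈ P :=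
    Submodule.subset_span ⟨0, 2, Or.inr rfl⟩
  have : pb flc fsin = (1 / 2 : ℝ) • fone +
      (1 / 2 : ℝ) • (fun p : ℝ × ℝ => p.2 ^ 0 * Real.cos ((2 : ℕ) * p.1)) := by
    rw [pb_lc_sin]; funext p
    simp [fone, Real.cos_two_mul]; ring
  rw [this]
  exact P.add_mem (P.smul_mem _ fone_mem_P) (P.smul_mem _ h2)

lemma pb_diff : pb flc fsin - pb fls fcos = fone := by
  rw [pb_lc_sin, pb_ls_cos]; funext p
  simp [fone]

lemma pb_ls_cos_mem : pb fls fcos ∈ P := by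
  have : pb fls fcos = pb flc fsin - fone := by rw [← pb_diff]; abel
  rw [this]
  exact P.sub_mem pb_lc_sin_mem fone_mem_P

/-- exponentials -/
def ee (n : ℤ) : Dom := ⟨fun t : ℝ => Complex.exp (n * t * Complex.I), by
  constructor
  · have h : ContDiff ℝ (⊤ : ℕ∞) (fun t : ℝ => (t : ℂ)) := Complex.ofRealCLM.contDiff
    exact ((contDiff_const.mul h).mul contDiff_const).cexp
  · intro t
    refine Complex.exp_eq_exp_iff_exists_int.2 ⟨n, ?_⟩
    push_cast; ring⟩

lemma ee_apply (n : ℤ) (t : ℝ) : (ee n : ℝ → ℂ) t = Complex.exp (n * t * Complex.I) := rfl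

lemma ee_hasDeriv (n : ℤ) (t : ℝ) :
    HasDerivAt (ee n : ℝ → ℂ) (n * Complex.I * (ee n : ℝ → ℂ) t) t := by
  have h : HasDerivAt (fun t : ℝ => (t : ℂ)) 1 t := Complex.ofRealCLM.hasDerivAt
  have := ((h.const_mul (n : ℂ)).mul_const Complex.I).cexp
  refine this.congr_deriv ?_
  rw [ee_apply]; ring

lemma fourier_unique (h : Dom) (hh : ∀ n : ℤ, ip (ee n : ℝ → ℂ) (h : ℝ → ℂ) = 0) : h = 0 := by
  have : Fact (0 < 2 * Real.pi) := ⟨Real.two_pi_pos⟩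
  have hper : Function.Periodic (h : ℝ → ℂ) (2 * Real.pi) := h.2.2
  have hc : Continuous (h : ℝ → ℂ) := h.2.1.continuous
  let F : C(AddCircle (2 * Real.pi), ℂ) := ⟨hper.lift, continuous_coinduced_dom.2 hc⟩
  have hF : ∀ x : ℝ, F (x : AddCircle (2 * Real.pi)) = (h : ℝ → ℂ) x := fun x => rfl
  have hz : ∀ n : ℤ, fourierCoeff F n = 0 := by
    intro n
    rw [fourierCoeff_eq_intervalIntegral F n 0]
    have : (∫ x in (0:ℝ)..0 + 2 * Real.pi, @fourier (2 * Real.pi) (-n) x • F x) = 0 := by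
      rw [← hh n, ip, zero_add]
      refine intervalIntegral.integral_congr fun x _ => ?_
      simp only [smul_eq_mul, hF]
      congr 1
      rw [fourier_coe_apply, ee_apply, ← Complex.exp_conj]
      congr 1
      have : (Real.pi : ℂ) ≠ 0 := by exact_mod_cast Real.pi_ne_zero
      simp
      field_simp
    rw [this, smul_zero]
  have hz' : fourierCoeff F = fun _ => 0 := funext hz
  have hs : Summable (fourierCoeff F) := by rw [hz']; exact summable_zero
  apply Subtype.ext
  funext x
  have := has_pointwise_sum_fourier_series_of_summable hs (x : AddCircle (2 * Real.pi))
  rw [hz'] at this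
  simp only [zero_smul] at this
  have h0 := this.unique hasSum_zero
  rw [hF] at h0
  exact h0

lemma eigen (g : Dom) (n : ℤ)
    (hg : ∀ t, deriv (g : ℝ → ℂ) t = n * Complex.I * (g : ℝ → ℂ) t) :
    ∃ a : ℂ, g = a • ee n := by
  have hd : Differentiable ℝ (g : ℝ → ℂ) := g.2.1.differentiable (by simp)
  refine ⟨(g : ℝ → ℂ) 0, ?_⟩
  have key : ∀ t, HasDerivAt (fun t => (g : ℝ → ℂ) t * (ee (-n) : ℝ → ℂ) t) 0 t := by
    intro t
    refine ((hd t).hasDerivAt.mul (ee_hasDeriv (-n) t)).congr_deriv ?_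
    rw [hg]; push_cast; ring
  have hconst : ∀ t, (g : ℝ → ℂ) t * (ee (-n) : ℝ → ℂ) t = (g : ℝ → ℂ) 0 := by
    intro t
    have := is_const_of_deriv_eq_zero (fun t => (key t).differentiableAt)
      (fun t => (key t).deriv) t 0
    rw [this]; simp [ee_apply]
  apply Subtype.ext
  funext t
  have e1 : (ee (-n) : ℝ → ℂ) t * (ee n : ℝ → ℂ) t = 1 := by
    rw [ee_apply, ee_apply, ← Complex.exp_add, ← Complex.exp_zero]
    congr 1; push_cast; ring
  change _ = (g : ℝ → ℂ) 0 * (ee n : ℝ → ℂ) t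
  rw [← hconst t, mul_assoc, e1, mul_one]

lemma ip_smul_left (a : ℂ) (f g : Dom) :
    ip ((a • f : Dom) : ℝ → ℂ) (g : ℝ → ℂ) = (starRingEnd ℂ) a * ip f g := by
  rw [ip, ip, ← intervalIntegral.integral_const_mul]
  refine intervalIntegral.integral_congr fun x _ => ?_
  simp [mul_assoc]

lemma ip_smul_right (a : ℂ) (f g : Dom) :
    ip (f : ℝ → ℂ) ((a • g : Dom) : ℝ → ℂ) = a * ip f g := by
  rw [ip, ip, ← intervalIntegral.integral_const_mul]
  refine intervalIntegral.integral_congr fun x _ => ?_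
  simp; ring

lemma ip_intble (f g : Dom) : IntervalIntegrable
    (fun t => (starRingEnd ℂ) ((f : ℝ → ℂ) t) * (g : ℝ → ℂ) t) MeasureTheory.volume
    0 (2 * Real.pi) := by
  have h1 : Continuous (f : ℝ → ℂ) := f.2.1.continuous
  have h2 : Continuous (g : ℝ → ℂ) := g.2.1.continuous
  exact ((Complex.continuous_conj.comp h1).mul h2).intervalIntegrable _ _

lemma ip_add_left (f f' g : Dom) :
    ip ((f + f' : Dom) : ℝ → ℂ) (g : ℝ → ℂ) = ip f g + ip f' g := by
  rw [ip, ip, ip, ← intervalIntegral.integral_add (ip_intble f g) (ip_intble f' g)]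
  refine intervalIntegral.integral_congr fun x _ => ?_
  simp [add_mul]

lemma ip_add_right (f g g' : Dom) :
    ip (f : ℝ → ℂ) ((g + g' : Dom) : ℝ → ℂ) = ip f g + ip f g' := by
  rw [ip, ip, ip, ← intervalIntegral.integral_add (ip_intble f g) (ip_intble f g')]
  refine intervalIntegral.integral_congr fun x _ => ?_
  simp [mul_add]

lemma ip_ee (n : ℤ) : ip (ee n : ℝ → ℂ) (ee n : ℝ → ℂ) = 2 * Real.pi := by
  rw [ip]
  have : ∀ t : ℝ, (starRingEnd ℂ) ((ee n : ℝ → ℂ) t) * (ee n : ℝ → ℂ) t = 1 := by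
    intro t
    rw [ee_apply, ← Complex.exp_conj, ← Complex.exp_add, ← Complex.exp_zero]
    congr 1; simp
  simp [this]

lemma alg {R : Type*} [Ring R] [Algebra ℂ R] (A C S X Y : R)
    (h1 : (2 : ℂ) • X = Complex.I • (A * S - S * A))
    (h2 : (-2 : ℂ) • Y = Complex.I • (A * C - C * A))
    (h3 : 1 = Complex.I • (X * S - S * X) - Complex.I • (Y * C - C * Y))
    (h4 : C * C + S * S = 1) :
    C * A * C + S * A * S = A + 1 := by
  have hX : X = (Complex.I / 2) • (A * S - S * A) := by
    rw [div_eq_inv_mul, mul_smul, ← h1, smul_smul]; norm_num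
  have hY : Y = (-Complex.I / 2) • (A * C - C * A) := by
    have : (-Complex.I / 2 : ℂ) = (-2)⁻¹ * Complex.I := by ring
    rw [this, mul_smul, ← h2, smul_smul]; norm_num
  have e1 : A * (C * C) + A * (S * S) = A := by rw [← mul_add, h4, mul_one]
  have e2 : C * C * A + S * S * A = A := by rw [← add_mul, h4, one_mul]
  have i1 : Complex.I * (Complex.I / 2) = -(1/2) := by
    rw [← mul_div_assoc, Complex.I_mul_I]; ring
  have i2 : Complex.I * (-Complex.I / 2) = 1/2 := by
    rw [← mul_div_assoc, mul_neg, Complex.I_mul_I]; ring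
  have h5 : (1 : R) = (-(1/2) : ℂ) • ((A * S - S * A) * S - S * (A * S - S * A))
      - (1/2 : ℂ) • ((A * C - C * A) * C - C * (A * C - C * A)) := by
    rw [h3, hX, hY]
    simp only [smul_mul_assoc, mul_smul_comm, ← smul_sub, smul_smul, i1, i2]
  have h6 : (1 : R) = (-(1/2) : ℂ) •
      ((A * (C * C) + A * (S * S)) + (C * C * A + S * S * A)
        - (2 : ℂ) • (C * A * C + S * A * S)) := by
    rw [h5]
    simp only [mul_sub, sub_mul, mul_assoc]
    module
  rw [e1, e2] at h6
  have h7 : C * A * C + S * A * S = A + (-(1/2) : ℂ) • (A + A - (2 : ℂ) • (C * A * C + S * A * S)) := by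
    module
  rw [h7, ← h6]

lemma seq_quad (a : ℤ → ℂ) (h : ∀ n, a (n + 1) + a (n - 1) = 2 * a n + 2) (n : ℤ) :
    a n = n ^ 2 + (a 1 - a 0 - 1) * n + a 0 := by
  have key : ∀ n : ℤ, a n = n ^ 2 + (a 1 - a 0 - 1) * n + a 0 ∧
      a (n + 1) = (n + 1) ^ 2 + (a 1 - a 0 - 1) * (n + 1) + a 0 := by
    intro n
    induction n using Int.induction_on with
    | zero => simp
    | succ k ih =>
      refine ⟨by rw [ih.2]; push_cast; ring, ?_⟩
      have := h (k + 1)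
      rw [add_sub_cancel_right, ih.1, ih.2] at this
      push_cast at *
      linear_combination this
    | pred k ih =>
      have := h (-k)
      rw [ih.1, ih.2] at this
      rw [sub_add_cancel]
      refine ⟨?_, by rw [ih.1]; push_cast; ring⟩
      push_cast at *
      linear_combination this
  exact (key n).1

theorem stmt0 (ν : ℝ) (Q : P →ₗ[ℝ] (Dom →ₗ[ℂ] Dom)) (hQ : IsQuant P ν Q) :
    ∃ b c : ℝ,
      Q ⟨fell2, fell2_mem_P⟩ =
        Q ⟨fell, fell_mem_P⟩ ∘ₗ Q ⟨fell, fell_mem_P⟩ + (b : ℂ) • Q ⟨fell, fell_mem_P⟩ +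
          (c : ℂ) • (LinearMap.id : Dom →ₗ[ℂ] Dom) := by
  have hLt := hQ.map_ell fell_mem_P
  have hSt := hQ.map_sin fsin_mem_P
  have hCt := hQ.map_cos fcos_mem_P
  have symL := hQ.symm ⟨fell, fell_mem_P⟩
  have symA := hQ.symm ⟨fell2, fell2_mem_P⟩
  have hcomm : Q ⟨fell, fell_mem_P⟩ ∘ₗ Q ⟨fell2, fell2_mem_P⟩ =
      Q ⟨fell2, fell2_mem_P⟩ ∘ₗ Q ⟨fell, fell_mem_P⟩ := by
    have h0 : pb fell fell2 ∈ P := by rw [pb_ell_ell2]; exact P.zero_mem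
    have := hQ.map_bracket ⟨fell, fell_mem_P⟩ ⟨fell2, fell2_mem_P⟩ h0
    have hz : (⟨pb fell fell2, h0⟩ : P) = 0 := Subtype.ext pb_ell_ell2
    rw [hz, map_zero] at this
    have h3 := (smul_eq_zero.1 this.symm).resolve_left Complex.I_ne_zero
    exact sub_eq_zero.1 h3
  have h1 : (2 : ℂ) • Q ⟨flc, flc_mem_P⟩ = Complex.I •
      (Q ⟨fell2, fell2_mem_P⟩ ∘ₗ Q ⟨fsin, fsin_mem_P⟩
        - Q ⟨fsin, fsin_mem_P⟩ ∘ₗ Q ⟨fell2, fell2_mem_P⟩) := by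
    have h0 : pb fell2 fsin ∈ P := by rw [pb_ell2_sin]; exact P.smul_mem _ flc_mem_P
    rw [← hQ.map_bracket ⟨fell2, fell2_mem_P⟩ ⟨fsin, fsin_mem_P⟩ h0]
    have hz : (⟨pb fell2 fsin, h0⟩ : P) = (2 : ℝ) • ⟨flc, flc_mem_P⟩ := Subtype.ext pb_ell2_sin
    rw [hz, map_smul, two_smul, two_smul]
  have h2 : (-2 : ℂ) • Q ⟨fls, fls_mem_P⟩ = Complex.I •
      (Q ⟨fell2, fell2_mem_P⟩ ∘ₗ Q ⟨fcos, fcos_mem_P⟩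
        - Q ⟨fcos, fcos_mem_P⟩ ∘ₗ Q ⟨fell2, fell2_mem_P⟩) := by
    have h0 : pb fell2 fcos ∈ P := by rw [pb_ell2_cos]; exact P.smul_mem _ fls_mem_P
    rw [← hQ.map_bracket ⟨fell2, fell2_mem_P⟩ ⟨fcos, fcos_mem_P⟩ h0]
    have hz : (⟨pb fell2 fcos, h0⟩ : P) = (-2 : ℝ) • ⟨fls, fls_mem_P⟩ := Subtype.ext pb_ell2_cos
    rw [hz, map_smul]
    ext ψ t
    change (-2 : ℂ) * (Q ⟨fls, fls_mem_P⟩ ψ : ℝ → ℂ) t = (-2 : ℝ) • (Q ⟨fls, fls_mem_P⟩ ψ : ℝ → ℂ) t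
    rw [Complex.real_smul]; push_cast; rfl
  have h3 : (LinearMap.id : Dom →ₗ[ℂ] Dom) =
      Complex.I • (Q ⟨flc, flc_mem_P⟩ ∘ₗ Q ⟨fsin, fsin_mem_P⟩
        - Q ⟨fsin, fsin_mem_P⟩ ∘ₗ Q ⟨flc, flc_mem_P⟩) -
      Complex.I • (Q ⟨fls, fls_mem_P⟩ ∘ₗ Q ⟨fcos, fcos_mem_P⟩
        - Q ⟨fcos, fcos_mem_P⟩ ∘ₗ Q ⟨fls, fls_mem_P⟩) := by
    rw [← hQ.map_bracket ⟨flc, flc_mem_P⟩ ⟨fsin, fsin_mem_P⟩ pb_lc_sin_mem,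
      ← hQ.map_bracket ⟨fls, fls_mem_P⟩ ⟨fcos, fcos_mem_P⟩ pb_ls_cos_mem,
      ← hQ.map_one fone_mem_P]
    have hz : (⟨fone, fone_mem_P⟩ : P) + ⟨pb fls fcos, pb_ls_cos_mem⟩ =
        ⟨pb flc fsin, pb_lc_sin_mem⟩ := Subtype.ext (by
          change fone + pb fls fcos = pb flc fsin
          rw [← pb_diff]; abel)
    have hz2 := congrArg Q hz
    rw [Q.map_add] at hz2
    apply LinearMap.ext
    intro ψ
    rw [LinearMap.sub_apply]
    exact eq_sub_of_add_eq (LinearMap.congr_fun hz2 ψ)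
  generalize Q ⟨flc, flc_mem_P⟩ = X at *
  generalize Q ⟨fls, fls_mem_P⟩ = Y at *
  generalize Q ⟨fell2, fell2_mem_P⟩ = A at *
  generalize Q ⟨fell, fell_mem_P⟩ = L at *
  generalize Q ⟨fsin, fsin_mem_P⟩ = S at *
  generalize Q ⟨fcos, fcos_mem_P⟩ = C at *
  have h4 : C ∘ₗ C + S ∘ₗ S = LinearMap.id := by
    ext ψ t
    change (C (C ψ) : ℝ → ℂ) t + (S (S ψ) : ℝ → ℂ) t = (ψ : ℝ → ℂ) t
    rw [hCt, hCt, hSt, hSt]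
    have : (Real.cos t : ℂ) * Real.cos t + (Real.sin t : ℂ) * Real.sin t = 1 := by
      have := Real.cos_sq_add_sin_sq t
      rw [sq, sq] at this
      exact_mod_cast this
    linear_combination (ψ : ℝ → ℂ) t * this
  have hmain := alg (R := Module.End ℂ Dom) A C S X Y h1 h2 h3 h4
  have hLe : ∀ n : ℤ, L (ee n) = ((n : ℂ) + ν) • ee n := by
    intro n
    ext t
    rw [hLt, (ee_hasDeriv n t).deriv]
    change _ = ((n : ℂ) + ν) * (ee n : ℝ → ℂ) t
    linear_combination (-(n : ℂ) * (ee n : ℝ → ℂ) t) * Complex.I_mul_I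
  have hex : ∀ n : ℤ, ∃ a : ℂ, A (ee n) = a • ee n := by
    intro n
    apply eigen
    intro t
    have hh := LinearMap.congr_fun hcomm (ee n)
    change L (A (ee n)) = A (L (ee n)) at hh
    rw [hLe, map_smul] at hh
    have ht := congrArg (fun f : Dom => (f : ℝ → ℂ) t) hh
    change (L (A (ee n)) : ℝ → ℂ) t = ((n : ℂ) + ν) * (A (ee n) : ℝ → ℂ) t at ht
    rw [hLt] at ht
    linear_combination Complex.I * ht + (deriv (A (ee n) : ℝ → ℂ) t) * Complex.I_mul_I
  choose a ha using hex
  have hreal : ∀ n, (starRingEnd ℂ) (a n) = a n := by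
    intro n
    have := symA (ee n) (ee n)
    rw [ha, ip_smul_left, ip_smul_right, ip_ee] at this
    have hp : (2 * Real.pi : ℂ) ≠ 0 := by exact_mod_cast Real.two_pi_pos.ne'
    exact mul_right_cancel₀ hp this
  have hCe : ∀ n : ℤ, C (ee n) = (1 / 2 : ℂ) • (ee (n + 1) + ee (n - 1)) := by
    intro n
    ext t
    rw [hCt]
    change _ = (1 / 2 : ℂ) * ((ee (n + 1) : ℝ → ℂ) t + (ee (n - 1) : ℝ → ℂ) t)
    simp only [ee_apply]
    rw [Complex.ofReal_cos, Complex.cos, div_mul_eq_mul_div, add_mul, ← Complex.exp_add,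
      ← Complex.exp_add]
    push_cast
    ring_nf
  have hSe : ∀ n : ℤ, S (ee n) = (-Complex.I / 2 : ℂ) • (ee (n + 1) - ee (n - 1)) := by
    intro n
    ext t
    rw [hSt]
    change _ = (-Complex.I / 2 : ℂ) * ((ee (n + 1) : ℝ → ℂ) t - (ee (n - 1) : ℝ → ℂ) t)
    have e1 : (ee (n + 1) : ℝ → ℂ) t = Complex.exp (t * Complex.I) * (ee n : ℝ → ℂ) t := by
      simp only [ee_apply]; rw [← Complex.exp_add]; congr 1; push_cast; ring
    have e2 : (ee (n - 1) : ℝ → ℂ) t = Complex.exp (-t * Complex.I) * (ee n : ℝ → ℂ) t := by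
      simp only [ee_apply]; rw [← Complex.exp_add]; congr 1; push_cast; ring
    rw [e1, e2, Complex.ofReal_sin, Complex.sin]
    ring
  have hrec : ∀ n, a (n + 1) + a (n - 1) = 2 * a n + 2 := by
    intro n
    have hh := LinearMap.congr_fun hmain (ee n)
    change C (A (C (ee n))) + S (A (S (ee n))) = A (ee n) + ee n at hh
    simp only [hCe, hSe, ha, map_smul, map_add, map_sub, add_sub_cancel_right,
      sub_add_cancel] at hh
    have ht := congrArg (fun f : Dom => (f : ℝ → ℂ) 0) hh
    simp [ee_apply] at ht
    ring_nf at ht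
    ring_nf
    linear_combination 2 * ht
  have hq := seq_quad a hrec
  have hre : ∀ n, ((a n).re : ℂ) = a n := fun n => Complex.conj_eq_iff_re.1 (hreal n)
  refine ⟨(a 1).re - (a 0).re - 1 - 2 * ν,
    (a 0).re - ν ^ 2 - ((a 1).re - (a 0).re - 1 - 2 * ν) * ν, ?_⟩
  set b : ℝ := (a 1).re - (a 0).re - 1 - 2 * ν with hb
  set c : ℝ := (a 0).re - ν ^ 2 - b * ν with hc
  have hAe : ∀ n : ℤ, A (ee n) = L (L (ee n)) + (b : ℂ) • L (ee n) + (c : ℂ) • ee n := by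
    intro n
    rw [ha, hLe, map_smul, hLe, smul_smul, smul_smul, ← add_smul, ← add_smul, hq n, hc, hb]
    congr 1
    push_cast
    rw [hre, hre]
    ring
  apply LinearMap.ext
  intro ψ
  change A ψ = L (L ψ) + (b : ℂ) • L ψ + (c : ℂ) • ψ
  rw [← sub_eq_zero]
  apply fourier_unique
  intro n
  have e := symA (ee n) ψ
  rw [hAe, ip_add_left, ip_add_left, ip_smul_left, ip_smul_left, symL, symL, symL,
    Complex.conj_ofReal, Complex.conj_ofReal] at e
  rw [sub_eq_add_neg, ← neg_one_smul ℂ (L (L ψ) + (b : ℂ) • L ψ + (c : ℂ) • ψ), ip_add_right,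
    ip_smul_right, ip_add_right, ip_add_right, ip_smul_right, ip_smul_right, ← e]
  ring
end
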